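/- Let P be a positive random field on X^{ℤ^d} and F a filtration. Let V and I be disjoint finite nonempty subsets of ℤ^d and let x̄ ∈ 𝒳_{V∪I}(F) be such that g_{V∪I}^{x̄}(w) > 0 for all w ∈ X^{V∪I}. Then for all x, u ∈ X^V and y, v ∈ X^I, the boundary conditions x̄y ∈ 𝒳_V(F) and x̄u ∈ 𝒳_I(F), the corresponding limits are positive, and the transition energies satisfy the additivity property Δ_{V∪I}^{x̄}(xy, uv) = Δ_V^{x̄y}(x,u) + Δ_I^{x̄u}(y,v). -/

import Mathlib

open MeasureTheory Filter Topology

noncomputable section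

/-- Sites of the lattice `ℤ^d`. -/
abbrev Site (d : ℕ) := Fin d → ℤ

/-- Configurations on the whole lattice. -/
abbrev Config (d : ℕ) (X : Type*) := Site d → X

variable {d : ℕ} {X : Type*}

/-- The configuration equal to `x` on `V` and to `z` off `V` (the concatenation `xz`). -/
def concat (V : Finset (Site d)) (x z : Config d X) : Config d X :=
  fun t => if t ∈ V then x t else z t

/-- The configuration equal to `u` on `I` and to `y` off `I`. -/
def extCfg (I : Finset (Site d)) (u : {s // s ∈ I} → X) (y : Config d X) : Config d X :=
  fun t => if h : t ∈ I then u ⟨t, h⟩ else y t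

/-- The cylinder set determined by the values of `z` on `Λ`. -/
def cyl (Λ : Finset (Site d)) (z : Config d X) : Set (Config d X) :=
  {ω | ∀ t ∈ Λ, ω t = z t}

/-- Finite-dimensional distribution `P_Λ(z)`. -/
def fdd [MeasurableSpace X] (P : Measure (Config d X)) (Λ : Finset (Site d))
    (z : Config d X) : ℝ :=
  (P (cyl Λ z)).toReal

/-- A positive random field: all finite-dimensional distributions are positive. -/
def IsPositiveRF [MeasurableSpace X] (P : Measure (Config d X)) : Prop :=
  ∀ Λ : Finset (Site d), Λ.Nonempty → ∀ z : Config d X, 0 < fdd P Λ z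

/-- Finite-conditional probability `g_V^z(x)` with boundary condition `z` on `Λ`. -/
def gfin [MeasurableSpace X] (P : Measure (Config d X)) (V Λ : Finset (Site d))
    (x z : Config d X) : ℝ :=
  fdd P (V ∪ Λ) (concat V x z) / fdd P Λ z

/-- A filtration: an increasing sequence of finite subsets of the lattice with union `ℤ^d`. -/
structure Filt (d : ℕ) where
  Λ : ℕ → Finset (Site d)
  mono : Monotone Λ
  covers : ∀ t : Site d, ∃ n, t ∈ Λ n

/-- The set `𝒳_V(F)` of admissible boundary conditions: those `x̄` for which all the limits
`lim_n g_V^{x̄_{Λ_n ∖ V}}(x)` exist. (Only the values of `x̄` off `V` are ever used.) -/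
def admissible [MeasurableSpace X] (P : Measure (Config d X)) (V : Finset (Site d))
    (F : Filt d) : Set (Config d X) :=
  {xb | ∀ x : Config d X, ∃ L : ℝ,
    Tendsto (fun n => gfin P V (F.Λ n \ V) x xb) atTop (𝓝 L)}

/-- The conditional probability `g_V^{x̄}(x)` : the limit of `g_V^{x̄_{Λ_n ∖ V}}(x)`. -/
def gCond [MeasurableSpace X] (P : Measure (Config d X)) (V : Finset (Site d))
    (F : Filt d) (xb x : Config d X) : ℝ :=
  limUnder atTop (fun n => gfin P V (F.Λ n \ V) x xb)

/-- Transition energy `Δ_V^{x̄}(x,u) = ln (g_V^{x̄}(x) / g_V^{x̄}(u))`. -/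
def TE [MeasurableSpace X] (P : Measure (Config d X)) (V : Finset (Site d))
    (F : Filt d) (xb x u : Config d X) : ℝ :=
  Real.log (gCond P V F xb x / gCond P V F xb u)

/-- Quasilocality (on boundary conditions off `V`) of a function `h` on a set `Y` of
boundary conditions. -/
def QuasilocalOn (V : Finset (Site d)) (Y : Set (Config d X)) (h : Config d X → ℝ) : Prop :=
  ∀ ε > 0, ∃ Λε : Finset (Site d), Disjoint Λε V ∧
    ∀ Λ : Finset (Site d), Disjoint Λ V → Λε ⊆ Λ →
      ∀ xb ∈ Y, ∀ yb ∈ Y, (∀ s ∈ Λ, xb s = yb s) → |h xb - h yb| < ε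

/-- `Y` represents a set of boundary conditions on `ℤ^d ∖ {t}`: membership does not depend
on the value at `t`. -/
def IsBCSet (t : Site d) (Y : Set (Config d X)) : Prop :=
  ∀ (ω : Config d X) (a : X), ω ∈ Y → Function.update ω t a ∈ Y

/-- `F` is a determining filtration for `P` with sets `Y t` of admissible boundary conditions:
the one-point finite-conditional probabilities converge, uniformly over `Y t`, to positive
limits, and `P(Y t) = 1`. -/
structure IsDetermining [MeasurableSpace X] (P : Measure (Config d X)) (F : Filt d)
    (Y : Site d → Set (Config d X)) : Prop where
  meas : ∀ t, MeasurableSet (Y t)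
  bc : ∀ t, IsBCSet t (Y t)
  adm : ∀ t, Y t ⊆ admissible P {t} F
  full : ∀ t, P (Y t) = 1
  pos : ∀ t, ∀ xb ∈ Y t, ∀ x : X, 0 < gCond P {t} F xb (fun _ => x)
  unif : ∀ (t : Site d) (x : X), ∀ ε > 0, ∃ N, ∀ n ≥ N, ∀ xb ∈ Y t,
    |gfin P {t} (F.Λ n \ {t}) (fun _ => x) xb - gCond P {t} F xb (fun _ => x)| < ε

/-- The probabilistic (Pr--) definition of a Gibbs random field. -/
def IsGibbsRF [MeasurableSpace X] (P : Measure (Config d X)) : Prop :=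
  IsProbabilityMeasure P ∧ IsPositiveRF P ∧
    ∃ (F : Filt d) (Y : Site d → Set (Config d X)), IsDetermining P F Y

theorem measurableSet_cyl [Fintype X] [MeasurableSpace X] [MeasurableSingletonClass X]
    (Λ : Finset (Site d)) (z : Config d X) : MeasurableSet (cyl Λ z) := by
  have h : cyl Λ z = ⋂ t ∈ Λ, (fun ω : Config d X => ω t) ⁻¹' {z t} := by
    ext ω; simp [cyl]
  rw [h]
  exact Finset.measurableSet_biInter _ fun t _ =>
    measurable_pi_apply t (measurableSet_singleton _)

theorem fdd_congr [MeasurableSpace X] (P : Measure (Config d X)) {Λ : Finset (Site d)}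
    {z z' : Config d X} (h : ∀ t ∈ Λ, z t = z' t) : fdd P Λ z = fdd P Λ z' := by
  have : cyl Λ z = cyl Λ z' := by
    ext ω
    exact forall₂_congr fun t ht => by rw [h t ht]
  rw [fdd, fdd, this]

theorem gfin_congr [MeasurableSpace X] (P : Measure (Config d X)) {V : Finset (Site d)}
    (Λ : Finset (Site d)) {x x' : Config d X} (z : Config d X) (h : ∀ t ∈ V, x t = x' t) :
    gfin P V Λ x z = gfin P V Λ x' z := by
  have : concat V x z = concat V x' z := by
    funext t
    by_cases ht : t ∈ V <;> simp [concat, ht, h]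
  rw [gfin, gfin, this]

theorem gCond_congr [MeasurableSpace X] (P : Measure (Config d X)) {V : Finset (Site d)}
    (F : Filt d) (z : Config d X) {x x' : Config d X} (h : ∀ t ∈ V, x t = x' t) :
    gCond P V F z x = gCond P V F z x' := by
  unfold gCond
  congr 1
  funext n
  exact gfin_congr P _ z h

theorem fdd_pos [MeasurableSpace X] {P : Measure (Config d X)} [IsProbabilityMeasure P]
    (hP : IsPositiveRF P) (Λ : Finset (Site d)) (z : Config d X) : 0 < fdd P Λ z := by
  rcases Λ.eq_empty_or_nonempty with rfl | h
  · simp [fdd, cyl]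
  · exact hP Λ h z

/-- Consistency of the finite-dimensional distributions. -/
theorem fdd_eq_sum [Fintype X] [MeasurableSpace X] [MeasurableSingletonClass X]
    (P : Measure (Config d X)) [IsProbabilityMeasure P] {V M : Finset (Site d)}
    (hVM : Disjoint V M) (z : Config d X) :
    fdd P M z = ∑ w : {s // s ∈ V} → X, fdd P (V ∪ M) (extCfg V w z) := by
  have hcyl : cyl M z = ⋃ w : {s // s ∈ V} → X, cyl (V ∪ M) (extCfg V w z) := by
    ext ω
    simp only [cyl, Set.mem_ofPred_eq, Set.mem_iUnion]
    constructor
    · intro h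
      refine ⟨fun t => ω t, fun t ht => ?_⟩
      by_cases htV : t ∈ V
      · simp [extCfg, htV]
      · simpa [extCfg, htV] using h t ((Finset.mem_union.1 ht).resolve_left htV)
    · rintro ⟨w, h⟩ t ht
      have htV : t ∉ V := fun h' => Finset.disjoint_left.1 hVM h' ht
      simpa [extCfg, htV] using h t (Finset.mem_union_right _ ht)
  have hdisj : Pairwise (Function.onFun Disjoint
      fun w : {s // s ∈ V} → X => cyl (V ∪ M) (extCfg V w z)) := by
    intro w w' hne
    refine Set.disjoint_left.2 fun ω h h' => hne (funext fun t => ?_)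
    have e := h t (Finset.mem_union_left _ t.2)
    have e' := h' t (Finset.mem_union_left _ t.2)
    simpa [extCfg] using e.symm.trans e'
  unfold fdd
  rw [hcyl, measure_iUnion hdisj fun w => measurableSet_cyl _ _, tsum_fintype,
    ENNReal.toReal_sum fun _ _ => measure_ne_top _ _]

theorem gfin_concat_eq_div [Fintype X] [MeasurableSpace X] [MeasurableSingletonClass X]
    {P : Measure (Config d X)} [IsProbabilityMeasure P] (hP : IsPositiveRF P)
    {V I Λ : Finset (Site d)} (hΛ : V ∪ I ⊆ Λ) (xb w y : Config d X) :
    gfin P V (Λ \ V) w (concat I y xb) =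
      gfin P (V ∪ I) (Λ \ (V ∪ I)) (concat V w y) xb /
        ∑ w' : {s // s ∈ V} → X, gfin P (V ∪ I) (Λ \ (V ∪ I)) (extCfg V w' y) xb := by
  have hne := (fdd_pos hP (Λ \ (V ∪ I)) xb).ne'
  unfold gfin
  rw [← Finset.sum_div, div_div_div_cancel_right₀ hne,
    fdd_eq_sum P Finset.disjoint_sdiff (concat I y xb),
    Finset.union_sdiff_of_subset (Finset.union_subset_left hΛ),
    Finset.union_sdiff_of_subset hΛ]
  congr 1
  · refine fdd_congr P fun t _ => ?_
    by_cases hV : t ∈ V <;> by_cases hI : t ∈ I <;> simp [concat, hV, hI]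
  · refine Finset.sum_congr rfl fun w' _ => fdd_congr P fun t _ => ?_
    by_cases hV : t ∈ V <;> by_cases hI : t ∈ I <;> simp [concat, extCfg, hV, hI]

theorem Filt.eventually_subset (F : Filt d) (W : Finset (Site d)) :
    ∀ᶠ n in atTop, W ⊆ F.Λ n := by
  have h : ∀ᶠ n in atTop, ∀ t ∈ W, t ∈ F.Λ n := by
    refine (Finset.eventually_all W).2 fun t _ => ?_
    obtain ⟨N, hN⟩ := F.covers t
    exact eventually_atTop.2 ⟨N, fun n hn => F.mono hn hN⟩
  exact h

theorem tendsto_gfin_gCond [MeasurableSpace X] {P : Measure (Config d X)}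
    {V : Finset (Site d)} {F : Filt d} {xb : Config d X} (h : xb ∈ admissible P V F)
    (x : Config d X) :
    Tendsto (fun n => gfin P V (F.Λ n \ V) x xb) atTop (𝓝 (gCond P V F xb x)) :=
  tendsto_nhds_limUnder (h x)

/-- Conditioning further on the values in `I` amounts to normalising the conditional
probability on `V ∪ I`. -/
theorem tendsto_gfin_concat [Fintype X] [Nonempty X] [MeasurableSpace X]
    [MeasurableSingletonClass X] {P : Measure (Config d X)} [IsProbabilityMeasure P]
    (hP : IsPositiveRF P) {F : Filt d} {V I : Finset (Site d)}
    {xb : Config d X} (hxb : xb ∈ admissible P (V ∪ I) F)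
    (hpos : ∀ w : Config d X, 0 < gCond P (V ∪ I) F xb w) (y : Config d X) :
    ∃ S : ℝ, 0 < S ∧ ∀ w : Config d X,
      Tendsto (fun n => gfin P V (F.Λ n \ V) w (concat I y xb)) atTop
        (𝓝 (gCond P (V ∪ I) F xb (concat V w y) / S)) := by
  have hS : 0 < ∑ w' : {s // s ∈ V} → X, gCond P (V ∪ I) F xb (extCfg V w' y) :=
    Finset.sum_pos (fun _ _ => hpos _) Finset.univ_nonempty
  refine ⟨_, hS, fun w => ?_⟩
  refine ((tendsto_gfin_gCond hxb _).div
    (tendsto_finsetSum _ fun w' _ => tendsto_gfin_gCond hxb (extCfg V w' y)) hS.ne').congr' ?_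
  filter_upwards [F.eventually_subset (V ∪ I)] with n hn
  exact (gfin_concat_eq_div hP hn xb w y).symm

/-- additivity of transition energies, relation (7) / `DeltaP-2`. -/
theorem stmt4 [Fintype X] [Nontrivial X] [MeasurableSpace X] [MeasurableSingletonClass X]
    (P : Measure (Config d X)) [IsProbabilityMeasure P] (hP : IsPositiveRF P)
    (F : Filt d) (V I : Finset (Site d)) (hV : V.Nonempty) (hI : I.Nonempty)
    (hVI : Disjoint V I) (xb : Config d X) (hxb : xb ∈ admissible P (V ∪ I) F)
    (hpos : ∀ w : Config d X, 0 < gCond P (V ∪ I) F xb w) :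
    ∀ x u y v : Config d X,
      concat I y xb ∈ admissible P V F ∧
      concat V u xb ∈ admissible P I F ∧
      (∀ w : Config d X, 0 < gCond P V F (concat I y xb) w) ∧
      (∀ w : Config d X, 0 < gCond P I F (concat V u xb) w) ∧
      TE P (V ∪ I) F xb (concat V x y) (concat V u v) =
        TE P V F (concat I y xb) x u + TE P I F (concat V u xb) y v := by
  intro x u y v
  have hxb' : xb ∈ admissible P (I ∪ V) F := by rwa [Finset.union_comm]
  have hpos' : ∀ w : Config d X, 0 < gCond P (I ∪ V) F xb w := by rwa [Finset.union_comm]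
  obtain ⟨S, hS, hlimV⟩ := tendsto_gfin_concat hP hxb hpos y
  obtain ⟨T, hT, hlimI⟩ := tendsto_gfin_concat hP hxb' hpos' u
  have swap : ∀ w, gCond P (I ∪ V) F xb (concat I w u) =
      gCond P (V ∪ I) F xb (concat V u w) := by
    intro w
    rw [Finset.union_comm I V]
    refine gCond_congr P F xb fun t ht => ?_
    rcases Finset.mem_union.1 ht with h | h
    · simp [concat, h, Finset.disjoint_left.1 hVI h]
    · simp [concat, h, Finset.disjoint_right.1 hVI h]
  have eV : ∀ w, gCond P V F (concat I y xb) w =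
      gCond P (V ∪ I) F xb (concat V w y) / S := fun w => (hlimV w).limUnder_eq
  have eI : ∀ w, gCond P I F (concat V u xb) w =
      gCond P (V ∪ I) F xb (concat V u w) / T := fun w => by
    rw [← swap w]
    exact (hlimI w).limUnder_eq
  refine ⟨fun w => ⟨_, hlimV w⟩, fun w => ⟨_, hlimI w⟩, fun w => ?_, fun w => ?_, ?_⟩
  · rw [eV]; exact div_pos (hpos _) hS
  · rw [eI]; exact div_pos (hpos _) hT
  · unfold TE
    rw [eV, eV, eI, eI, div_div_div_cancel_right₀ hS.ne', div_div_div_cancel_right₀ hT.ne',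
      Real.log_div (hpos _).ne' (hpos _).ne', Real.log_div (hpos _).ne' (hpos _).ne',
      Real.log_div (hpos _).ne' (hpos _).ne']
    ring
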